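/- Suppose f : ℝ^d → ℝ is real-valued with f̂ ∈ L¹(ℝ^d), ‖f‖_{B^log} < ∞ and ‖f‖_{B⁰} > 0. For any compact set Ω ⊂ [0,1]^d and any m ∈ ℕ, there exists a single ReLU network F : ℝ^d → ℝ of width d+4 and depth at most 6m·‖f‖_{B^log}/‖f‖_{B⁰} such that ‖f − F‖_{L²(Ω)} ≤ (2π²/√m)·|Ω|^{1/2}·‖f‖_{B⁰}. -/

import Mathlib

open MeasureTheory Real Filter

noncomputable section

/-- The ℓ¹ norm on `ℝ^d`. -/
def l1 {d : ℕ} (ξ : Fin d → ℝ) : ℝ := ∑ i, |ξ i|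

/-- The Fourier transform `f̂(ξ) = ∫ f(x) e^{-2πi ξ·x} dx`. -/
def fhat {d : ℕ} (f : (Fin d → ℝ) → ℂ) (ξ : Fin d → ℝ) : ℂ :=
  ∫ x : Fin d → ℝ,
    Complex.exp (-(2 * (Real.pi : ℂ) * Complex.I * ((∑ i, ξ i * x i : ℝ) : ℂ))) * f x

/-- Fourier transform of a real-valued function. -/
def fhatR {d : ℕ} (f : (Fin d → ℝ) → ℝ) : (Fin d → ℝ) → ℂ :=
  fhat (fun x => (f x : ℂ))

/-- log-Barron norm `∫ log₂(2+‖ξ‖₁)|g(ξ)| dξ` of a frequency-side function `g`. -/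
def logBarron {d : ℕ} (g : (Fin d → ℝ) → ℂ) : ℝ :=
  ∫ ξ : Fin d → ℝ, Real.logb 2 (2 + l1 ξ) * ‖g ξ‖

/-- Barron norm of order 0 : `∫ (1 + ‖ξ‖₁⁰)|g(ξ)| dξ = 2∫|g(ξ)|dξ`. -/
def B0 {d : ℕ} (g : (Fin d → ℝ) → ℂ) : ℝ := 2 * ∫ ξ : Fin d → ℝ, ‖g ξ‖

/-- Barron norm of order 1 : `∫ (1 + ‖ξ‖₁)|g(ξ)| dξ`. -/
def B1 {d : ℕ} (g : (Fin d → ℝ) → ℂ) : ℝ := ∫ ξ : Fin d → ℝ, (1 + l1 ξ) * ‖g ξ‖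

/-- first-order log-Barron norm `∫ (1+‖ξ‖₁) log₂(2+‖ξ‖₁)|g(ξ)| dξ`. -/
def B1log {d : ℕ} (g : (Fin d → ℝ) → ℂ) : ℝ :=
  ∫ ξ : Fin d → ℝ, (1 + l1 ξ) * Real.logb 2 (2 + l1 ξ) * ‖g ξ‖

/-- One hidden ReLU layer `z ↦ ReLU(Wz+b)`. -/
def reluLayer {N : ℕ} (W : Matrix (Fin N) (Fin N) ℝ) (b : Fin N → ℝ) (z : Fin N → ℝ) :
    Fin N → ℝ :=
  fun i => max 0 (W.mulVec z i + b i)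

/-- Iterate `k` hidden layers. -/
def hiddenIter {N : ℕ} (W : ℕ → Matrix (Fin N) (Fin N) ℝ) (b : ℕ → Fin N → ℝ) :
    ℕ → (Fin N → ℝ) → (Fin N → ℝ)
  | 0, z => z
  | k + 1, z => reluLayer (W k) (b k) (hiddenIter W b k z)

/-- `F : ℝ^d → ℝ` is a ReLU network of width `N` and depth `L`:
`F(x) = W_L z_{L-1}`, `z₀ = x`, `z_l = ReLU(W_l z_{l-1} + b_l)` for `1 ≤ l ≤ L-1`. -/
def IsReLUNet (d N L : ℕ) (F : (Fin d → ℝ) → ℝ) : Prop :=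
  ∃ (W₁ : Matrix (Fin N) (Fin d) ℝ) (b₁ : Fin N → ℝ)
    (W : ℕ → Matrix (Fin N) (Fin N) ℝ) (b : ℕ → Fin N → ℝ) (Wout : Fin N → ℝ),
    ∀ x, F x = ∑ i, Wout i *
      hiddenIter W b (L - 2) (fun j => max 0 (W₁.mulVec x j + b₁ j)) i

/-- `v` is the `j`-th weak partial derivative of `u` on `Ω`. -/
def HasWeakPartial {d : ℕ} (Ω : Set (Fin d → ℝ)) (u : (Fin d → ℝ) → ℝ) (j : Fin d)
    (v : (Fin d → ℝ) → ℝ) : Prop :=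
  ∀ φ : (Fin d → ℝ) → ℝ, ContDiff ℝ (⊤ : ℕ∞) φ → HasCompactSupport φ → tsupport φ ⊆ interior Ω →
    ∫ x in Ω, u x * fderiv ℝ φ x (Pi.single j 1) = - ∫ x in Ω, v x * φ x

/-- Euclidean diameter of a set in `ℝ^d`. -/
def eucDiam {d : ℕ} (Ω : Set (Fin d → ℝ)) : ℝ :=
  sSup {r : ℝ | ∃ x ∈ Ω, ∃ y ∈ Ω, r = Real.sqrt (∑ i, (x i - y i) ^ 2)}



section FourierPart
open scoped FourierTransform ContDiff SchwartzMap RealInnerProductSpace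

lemma fourier_inv_ae {V : Type*} [NormedAddCommGroup V] [InnerProductSpace ℝ V]
    [FiniteDimensional ℝ V] [MeasurableSpace V] [BorelSpace V] (f : V → ℂ)
    (hf : Integrable f) (h'f : Integrable (𝓕 f)) : ∀ᵐ x, f x = 𝓕⁻ (𝓕 f) x := by
  have hc : Continuous (𝓕⁻ (𝓕 f)) := by
    have := VectorFourier.fourierIntegral_continuous (L := -innerₗ V) (μ := (volume : Measure V))
      Real.continuous_fourierChar (by simp only [LinearMap.neg_apply, innerₗ_apply_apply]; fun_prop) h'f
    exact this
  refine ae_eq_of_integral_contDiff_smul_eq hf.locallyIntegrable hc.locallyIntegrable ?_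
  intro g hg hgs
  have h1 : HasCompactSupport (fun x => (g x : ℂ)) := hgs.comp_left (g := fun t : ℝ => (t : ℂ)) (by simp)
  have h2 : ContDiff ℝ ∞ (fun x => (g x : ℂ)) := Complex.ofRealCLM.contDiff.comp hg
  set φ : 𝓢(V, ℂ) := h1.toSchwartzMap h2 with hφ
  have hφa : ∀ x, φ x = (g x : ℂ) := fun x => rfl
  have e1 : ∫ x, g x • f x = ∫ x, 𝓕 (𝓕⁻ φ : 𝓢(V, ℂ)) x • f x := by
    rw [FourierTransform.fourier_fourierInv_eq]
    simp [hφa]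
  have e2 : ∫ x, (𝓕 (𝓕⁻ φ : 𝓢(V, ℂ)) : 𝓢(V,ℂ)) x • f x = ∫ x, (𝓕⁻ φ : 𝓢(V, ℂ)) x • 𝓕 f x := by
    have := VectorFourier.integral_fourierIntegral_smul_eq_flip (L := innerₗ V)
      (μ := (volume : Measure V))
      Real.continuous_fourierChar continuous_inner (𝓕⁻ φ : 𝓢(V, ℂ)).integrable hf
    rw [flip_innerₗ] at this
    exact this
  have e3 : ∫ x, (𝓕⁻ φ : 𝓢(V, ℂ)) x • 𝓕 f x = ∫ x, φ x • 𝓕⁻ (𝓕 f) x := by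
    rw [SchwartzMap.fourierInv_coe]
    have := VectorFourier.integral_fourierIntegral_smul_eq_flip (L := -innerₗ V) (μ := (volume : Measure V))
      Real.continuous_fourierChar (by simp only [LinearMap.neg_apply, innerₗ_apply_apply]; fun_prop) φ.integrable h'f
    have hfl : (-innerₗ V).flip = -innerₗ V := by
      ext a b; simp [real_inner_comm]
    rw [hfl] at this
    exact this
  rw [e1, e2, e3]
  simp [hφa]

lemma fhat_eq {d : ℕ} (f : (Fin d → ℝ) → ℂ) (ξ : EuclideanSpace ℝ (Fin d)) :
    𝓕 (fun v : EuclideanSpace ℝ (Fin d) => f (WithLp.ofLp v)) ξ = fhat f (WithLp.ofLp ξ) := by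
  rw [Real.fourier_eq', fhat, ← (PiLp.volume_preserving_ofLp (Fin d)).integral_comp
    (MeasurableEquiv.toLp 2 _).symm.measurableEmbedding]
  refine integral_congr_ae (ae_of_all _ fun v => ?_)
  simp only [smul_eq_mul, PiLp.inner_apply, RCLike.inner_apply, conj_trivial]
  congr 2
  push_cast
  ring

lemma integrable_of_fhat {d : ℕ} (f : (Fin d → ℝ) → ℝ) (h : 0 < B0 (fhatR f)) : Integrable f := by
  by_contra hf
  have : fhatR f = 0 := by
    ext ξ
    have h0 : ¬ Integrable (fun x : Fin d → ℝ =>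
        Complex.exp (-(2 * (Real.pi : ℂ) * Complex.I * ((∑ i, ξ i * x i : ℝ) : ℂ))) * (f x : ℂ)) := by
      intro hi
      have hb := hi.bdd_mul (c := 1) (f := fun x : Fin d → ℝ =>
        Complex.exp ((2 * (Real.pi : ℂ) * Complex.I * ((∑ i, ξ i * x i : ℝ) : ℂ))))
        (Continuous.aestronglyMeasurable (by fun_prop)) (ae_of_all _ fun x => by
          rw [Complex.norm_exp]; simp)
      apply hf
      have := hb.re
      refine this.congr (ae_of_all _ fun x => ?_)
      simp only
      rw [← mul_assoc, ← Complex.exp_add]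
      simp
    show fhat _ ξ = 0
    exact integral_undef h0
  rw [this] at h
  simp [B0] at h

lemma fhat_continuous {d : ℕ} (f : (Fin d → ℝ) → ℝ) (hf : Integrable f) : Continuous (fhatR f) := by
  unfold fhatR fhat
  refine continuous_of_dominated (bound := fun x => ‖f x‖) ?_ ?_ hf.norm ?_
  · intro ξ
    exact (Continuous.aestronglyMeasurable (by fun_prop)).mul hf.ofReal.aestronglyMeasurable
  · intro ξ
    refine ae_of_all _ fun x => ?_
    rw [norm_mul, Complex.norm_exp]
    simp
  · refine ae_of_all _ fun x => ?_
    fun_prop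

/-- phase -/
def phase {d : ℕ} (f : (Fin d → ℝ) → ℝ) (ξ : Fin d → ℝ) : ℝ := Complex.arg (fhatR f ξ) / (2 * π)

lemma fourier_repr {d : ℕ} (f : (Fin d → ℝ) → ℝ) (hf : Integrable f)
    (hf1 : Integrable (fhatR f)) :
    ∀ᵐ x, f x = ∫ ξ, ‖fhatR f ξ‖ * Real.cos (2 * π * (∑ i, ξ i * x i + phase f ξ)) := by
  set g : EuclideanSpace ℝ (Fin d) → ℂ := fun v => ((f (WithLp.ofLp v) : ℝ) : ℂ) with hg
  have hmp := PiLp.volume_preserving_ofLp (Fin d)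
  have hme := (MeasurableEquiv.toLp 2 (Fin d → ℝ)).symm.measurableEmbedding
  have hgi : Integrable g := (hmp.integrable_comp_emb hme).2 hf.ofReal
  have hF : 𝓕 g = fun ξ => fhatR f (WithLp.ofLp ξ) := by
    ext ξ
    exact fhat_eq (fun x => (f x : ℂ)) ξ
  have hgi' : Integrable (𝓕 g) := by
    rw [hF]
    exact (hmp.integrable_comp_emb hme).2 hf1
  have h := fourier_inv_ae g hgi hgi'
  have h2 : ∀ᵐ x : Fin d → ℝ, g (WithLp.toLp 2 x) = 𝓕⁻ (𝓕 g) (WithLp.toLp 2 x) :=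
    (PiLp.volume_preserving_toLp (Fin d)).quasiMeasurePreserving.ae h
  filter_upwards [h2] with x hx
  rw [Real.fourierInv_eq', hF] at hx
  have e : ∫ v : EuclideanSpace ℝ (Fin d), Complex.exp (↑(2 * π * ⟪v, WithLp.toLp 2 x⟫) * Complex.I) •
      fhatR f (WithLp.ofLp v) = ∫ ξ, Complex.exp (↑(2 * π * ∑ i, ξ i * x i) * Complex.I) •
      fhatR f ξ := by
    rw [← hmp.integral_comp hme]
    refine integral_congr_ae (ae_of_all _ fun v => ?_)
    simp only [smul_eq_mul, PiLp.inner_apply, RCLike.inner_apply, conj_trivial]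
    simp only [mul_comm]
  rw [e] at hx
  have hre := congrArg Complex.re hx
  have hi : Integrable (fun ξ : Fin d → ℝ => Complex.exp (↑(2 * π * ∑ i, ξ i * x i) * Complex.I) •
      fhatR f ξ) := by
    refine hf1.bdd_mul (c := 1) (Continuous.aestronglyMeasurable (by fun_prop)) (ae_of_all _ fun x => by
          rw [Complex.norm_exp]; simp)
  have := integral_re hi
  simp only [RCLike.re_to_complex] at this
  rw [← this] at hre
  simp only [hg, Complex.ofReal_re] at hre
  rw [hre]
  refine integral_congr_ae (ae_of_all _ fun ξ => ?_)
  simp only [smul_eq_mul]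
  conv_lhs => rw [← Complex.norm_mul_exp_arg_mul_I (fhatR f ξ)]
  rw [mul_left_comm, ← Complex.exp_add, ← add_mul, ← Complex.ofReal_add, Complex.re_ofReal_mul,
    Complex.exp_ofReal_mul_I_re]
  congr 2
  unfold phase
  have := Real.pi_pos
  field_simp

end FourierPart

section NetPart

/-- triangle wave: distance to the nearest integer -/
def tri (t : ℝ) : ℝ := min (Int.fract t) (1 - Int.fract t)

lemma tri_nonneg (t : ℝ) : 0 ≤ tri t :=
  le_min (Int.fract_nonneg t) (by linarith [Int.fract_lt_one t])

lemma tri_le (t : ℝ) : tri t ≤ 1 / 2 := by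
  unfold tri
  rcases le_total (Int.fract t) (1/2) with h | h
  · exact (min_le_left _ _).trans h
  · exact (min_le_right _ _).trans (by linarith)

lemma tri_sub_int (t : ℝ) (n : ℤ) : tri (t - n) = tri t := by simp [tri]

lemma tri_neg (t : ℝ) : tri (-t) = tri t := by
  unfold tri
  by_cases h : Int.fract t = 0
  · rw [Int.fract_neg_eq_zero.2 h, h]
  · rw [Int.fract_neg h, min_comm]; simp

lemma tri_cases (t : ℝ) : ∃ n : ℤ, tri t = t - n ∨ tri t = -t - n := by
  unfold tri
  rcases min_choice (Int.fract t) (1 - Int.fract t) with h | h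
  · exact ⟨⌊t⌋, Or.inl (by rw [h]; rfl)⟩
  · refine ⟨-⌊t⌋ - 1, Or.inr ?_⟩
    rw [h, Int.fract]; push_cast; ring

lemma tri_two_tri (t : ℝ) : tri (2 * tri t) = tri (2 * t) := by
  obtain ⟨n, h | h⟩ := tri_cases t
  · rw [h, show 2 * (t - n) = 2 * t - ((2 * n : ℤ) : ℝ) by push_cast; ring, tri_sub_int]
  · rw [h, show 2 * (-t - n) = -(2 * t) - ((2 * n : ℤ) : ℝ) by push_cast; ring, tri_sub_int, tri_neg]

lemma cos_tri (t : ℝ) : Real.cos (2 * π * tri t) = Real.cos (2 * π * t) := by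
  obtain ⟨n, h | h⟩ := tri_cases t
  · rw [h, show 2 * π * (t - n) = 2 * π * t - n * (2 * π) by ring, Real.cos_sub_int_mul_two_pi]
  · rw [h, show 2 * π * (-t - n) = -(2 * π * t) - n * (2 * π) by ring,
      Real.cos_sub_int_mul_two_pi, Real.cos_neg]

lemma hat_eq (u : ℝ) (h0 : 0 ≤ u) (h1 : u ≤ 1) :
    2 * max 0 u - 4 * max 0 (u - 1 / 2) = 2 * tri u := by
  rw [max_eq_right h0]
  rcases h1.lt_or_eq with h | rfl
  · have : Int.fract u = u := Int.fract_eq_self.2 ⟨h0, h⟩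
    unfold tri
    rw [this]
    rcases le_total u (1 / 2) with h | h
    · rw [max_eq_left (by linarith), min_eq_left (by linarith)]; ring
    · rw [max_eq_right (by linarith), min_eq_right (by linarith)]; ring
  · rw [max_eq_right (by norm_num)]; simp [tri]; norm_num

variable {d : ℕ}

/-- network state: carried input and four working neurons -/
def stateOf (x : Fin d → ℝ) (r : Fin 4 → ℝ) : Fin (d + 4) → ℝ :=
  Sum.elim x r ∘ finSumFinEquiv.symm

lemma layer_state (V : Matrix (Fin 4) (Fin d) ℝ) (M : Matrix (Fin 4) (Fin 4) ℝ) (b : Fin 4 → ℝ)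
    (x : Fin d → ℝ) (hx : 0 ≤ x) (r : Fin 4 → ℝ) :
    reluLayer ((Matrix.fromBlocks (1 : Matrix (Fin d) (Fin d) ℝ) 0 V M).submatrix
      finSumFinEquiv.symm finSumFinEquiv.symm) (stateOf 0 b) (stateOf x r) =
      stateOf x (fun j => max 0 (V.mulVec x j + M.mulVec r j + b j)) := by
  ext i
  unfold reluLayer stateOf
  rw [Matrix.submatrix_mulVec_equiv]
  simp only [Equiv.symm_symm, Function.comp_apply]
  have : (Sum.elim x r ∘ finSumFinEquiv.symm) ∘ finSumFinEquiv = Sum.elim x r := by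
    ext j; simp
  rw [this, Matrix.fromBlocks_mulVec]
  rcases finSumFinEquiv.symm i with j | j
  · simp; exact hx j
  · simp

lemma init_state (p0 : ℝ) (hp : 0 ≤ p0) (x : Fin d → ℝ) (hx : 0 ≤ x) :
    (fun j => max 0 (((Matrix.fromRows (1 : Matrix (Fin d) (Fin d) ℝ)
      (0 : Matrix (Fin 4) (Fin d) ℝ)).submatrix finSumFinEquiv.symm (Equiv.refl _)).mulVec x j +
      stateOf 0 ![0, 0, p0, 0] j)) = stateOf x ![0, 0, p0, 0] := by
  ext i
  unfold stateOf
  rw [Matrix.submatrix_mulVec_equiv]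
  simp only [Equiv.refl_symm, Equiv.coe_refl, Function.comp_apply, Function.comp_id]
  rw [Matrix.fromRows_mulVec]
  rcases finSumFinEquiv.symm i with j | j
  · simp; exact hx j
  · fin_cases j <;> simp [hp]

lemma hiddenIter_congr {N : ℕ} {W W' : ℕ → Matrix (Fin N) (Fin N) ℝ} {b b' : ℕ → Fin N → ℝ}
    (H : ℕ) (h : ∀ k < H, W k = W' k ∧ b k = b' k) (z : Fin N → ℝ) :
    hiddenIter W b H z = hiddenIter W' b' H z := by
  induction H with
  | zero => rfl
  | succ k ih =>
    simp only [hiddenIter]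
    rw [ih (fun j hj => h j (by omega)), (h k (by omega)).1, (h k (by omega)).2]

/-- working neurons `r` are computable with `H` layers -/
def Reach (p0 : ℝ) (H : ℕ) (r : (Fin d → ℝ) → Fin 4 → ℝ) : Prop :=
  ∃ W b, ∀ x ∈ Set.Icc (0 : Fin d → ℝ) 1,
    hiddenIter W b H (stateOf x ![0, 0, p0, 0]) = stateOf x (r x)

lemma Reach.congr {p0 : ℝ} {H : ℕ} {r r' : (Fin d → ℝ) → Fin 4 → ℝ} (h : Reach p0 H r)
    (hr : ∀ x ∈ Set.Icc (0 : Fin d → ℝ) 1, r x = r' x) : Reach p0 H r' := by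
  obtain ⟨W, b, h⟩ := h
  exact ⟨W, b, fun x hx => by rw [h x hx, hr x hx]⟩

lemma Reach.step {p0 : ℝ} {H : ℕ} {r : (Fin d → ℝ) → Fin 4 → ℝ} (h : Reach p0 H r)
    (V : Matrix (Fin 4) (Fin d) ℝ) (M : Matrix (Fin 4) (Fin 4) ℝ) (b : Fin 4 → ℝ) :
    Reach p0 (H + 1) (fun x j => max 0 (V.mulVec x j + M.mulVec (r x) j + b j)) := by
  obtain ⟨W, b', h⟩ := h
  refine ⟨Function.update W H ((Matrix.fromBlocks (1 : Matrix (Fin d) (Fin d) ℝ) 0 V M).submatrix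
      finSumFinEquiv.symm finSumFinEquiv.symm), Function.update b' H (stateOf 0 b), fun x hx => ?_⟩
  rw [hiddenIter, Function.update_self, Function.update_self,
    hiddenIter_congr (W' := W) (b' := b'), h x hx, layer_state _ _ _ _ hx.1]
  intro k hk
  rw [Function.update_of_ne hk.ne, Function.update_of_ne hk.ne]
  exact ⟨rfl, rfl⟩

/-- Value of the accumulators. -/
def ReachAcc (p0 : ℝ) (H : ℕ) (a b p q : (Fin d → ℝ) → ℝ) : Prop :=
  Reach p0 H (fun x => ![a x, b x, p x, q x])

lemma ReachAcc.load {p0 : ℝ} {H : ℕ} {a b p q : (Fin d → ℝ) → ℝ} (h : ReachAcc p0 H a b p q)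
    (hp : ∀ x, 0 ≤ p x) (hq : ∀ x, 0 ≤ q x) (w : Fin d → ℝ) (t : ℝ) :
    ReachAcc p0 (H + 1) (fun x => max 0 (∑ i, w i * x i + t))
      (fun x => max 0 (∑ i, w i * x i + t - 1 / 2)) p q := by
  refine (Reach.step h (Matrix.of ![w, w, 0, 0])
    (Matrix.of ![![0,0,0,0],![0,0,0,0],![0,0,1,0],![0,0,0,1]]) ![t, t - 1/2, 0, 0]).congr ?_
  intro x hx
  ext j
  fin_cases j <;> simp [Matrix.mulVec, dotProduct, Fin.sum_univ_four, hp, hq, add_sub_assoc]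

lemma ReachAcc.hat {p0 : ℝ} {H : ℕ} {a b p q : (Fin d → ℝ) → ℝ} (h : ReachAcc p0 H a b p q)
    (hp : ∀ x, 0 ≤ p x) (hq : ∀ x, 0 ≤ q x) :
    ReachAcc p0 (H + 1) (fun x => max 0 (2 * a x - 4 * b x))
      (fun x => max 0 (2 * a x - 4 * b x - 1 / 2)) p q := by
  refine (Reach.step h 0
    (Matrix.of ![![2,-4,0,0],![2,-4,0,0],![0,0,1,0],![0,0,0,1]]) ![0, - 1/2, 0, 0]).congr ?_
  intro x hx
  ext j
  fin_cases j <;> simp [Matrix.mulVec, dotProduct, Fin.sum_univ_four, hp, hq] <;> ring_nf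

lemma ReachAcc.emit {p0 : ℝ} {H : ℕ} {a b p q : (Fin d → ℝ) → ℝ} (h : ReachAcc p0 H a b p q)
    (hp : ∀ x, 0 ≤ p x) (hq : ∀ x, 0 ≤ q x) (s : ℝ) :
    ReachAcc p0 (H + 1) (fun x => max 0 (a x - 2 * b x - s)) 0 p q := by
  refine (Reach.step h 0
    (Matrix.of ![![1,-2,0,0],![0,0,0,0],![0,0,1,0],![0,0,0,1]]) ![-s, 0, 0, 0]).congr ?_
  intro x hx
  ext j
  fin_cases j <;> simp [Matrix.mulVec, dotProduct, Fin.sum_univ_four, hp, hq] <;> ring_nf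

lemma ReachAcc.flush {p0 : ℝ} {H : ℕ} {a b p q : (Fin d → ℝ) → ℝ} (h : ReachAcc p0 H a b p q)
    (ha : ∀ x, 0 ≤ a x)
    (hp : ∀ x, 0 ≤ p x) (hq : ∀ x, 0 ≤ q x) (c : ℝ) :
    ReachAcc p0 (H + 1) 0 0 (fun x => p x + max 0 c * a x) (fun x => q x + max 0 (-c) * a x) := by
  refine (Reach.step h 0
    (Matrix.of ![![0,0,0,0],![0,0,0,0],![max 0 c,0,1,0],![max 0 (-c),0,0,1]]) 0).congr ?_
  intro x hx
  have h1 : 0 ≤ max 0 c * a x + p x := add_nonneg (mul_nonneg (le_max_left _ _) (ha x)) (hp x)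
  have h2 : 0 ≤ max 0 (-c) * a x + q x := add_nonneg (mul_nonneg (le_max_left _ _) (ha x)) (hq x)
  ext j
  fin_cases j <;> simp [Matrix.mulVec, dotProduct, Fin.sum_univ_four, max_eq_right h1, max_eq_right h2] <;> ring

/-- number of doublings for frequency `ξ` -/
def dbl (ξ : Fin d → ℝ) : ℕ := ⌈Real.logb 2 (2 + l1 ξ)⌉₊

lemma l1_nonneg (ξ : Fin d → ℝ) : 0 ≤ l1 ξ := Finset.sum_nonneg fun _ _ => abs_nonneg _

lemma two_pow_dbl (ξ : Fin d → ℝ) : 2 + l1 ξ ≤ 2 ^ dbl ξ := by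
  have h := l1_nonneg ξ
  have := Nat.le_ceil (Real.logb 2 (2 + l1 ξ))
  rw [Real.logb_le_iff_le_rpow (by norm_num) (by linarith), Real.rpow_natCast] at this
  exact this

lemma range_bound (ξ : Fin d → ℝ) (θ : ℝ) : ∃ n : ℤ, ∀ x ∈ Set.Icc (0 : Fin d → ℝ) 1,
    0 ≤ ∑ i, ξ i * x i + θ - n ∧ ∑ i, ξ i * x i + θ - n ≤ 2 + l1 ξ := by
  refine ⟨⌊∑ i, min 0 (ξ i) + θ⌋, fun x hx => ?_⟩
  have h1 := Int.floor_le (∑ i, min 0 (ξ i) + θ)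
  have h2 := Int.lt_floor_add_one (∑ i, min 0 (ξ i) + θ)
  have h3 : ∑ i, min 0 (ξ i) ≤ ∑ i, ξ i * x i := by
    refine Finset.sum_le_sum fun i _ => ?_
    have a := hx.1 i; have b := hx.2 i
    simp at a b
    rcases le_total 0 (ξ i) with h | h
    · rw [min_eq_left h]; positivity
    · rw [min_eq_right h]; nlinarith
  have h4 : ∑ i, ξ i * x i ≤ ∑ i, min 0 (ξ i) + l1 ξ := by
    rw [l1, ← Finset.sum_add_distrib]
    refine Finset.sum_le_sum fun i _ => ?_
    have a := hx.1 i; have b := hx.2 i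
    simp at a b
    rcases le_total 0 (ξ i) with h | h
    · rw [min_eq_left h, abs_of_nonneg h]; nlinarith
    · rw [min_eq_right h, abs_of_nonpos h]; nlinarith
  constructor <;> linarith

lemma ReachAcc.hats {p0 : ℝ} {H : ℕ} {a b p q : (Fin d → ℝ) → ℝ} (h : ReachAcc p0 H a b p q)
    (hp : ∀ x, 0 ≤ p x) (hq : ∀ x, 0 ≤ q x) (w : Fin d → ℝ) (t : ℝ)
    (hw : ∀ x ∈ Set.Icc (0 : Fin d → ℝ) 1, 0 ≤ ∑ i, w i * x i + t ∧ ∑ i, w i * x i + t ≤ 1) (j : ℕ) :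
    ∃ a' b', ReachAcc p0 (H + 1 + j) a' b' p q ∧ ∀ x ∈ Set.Icc (0 : Fin d → ℝ) 1,
      2 * a' x - 4 * b' x = 2 * tri (2 ^ j * (∑ i, w i * x i + t)) := by
  induction j with
  | zero =>
    refine ⟨_, _, h.load hp hq w t, fun x hx => ?_⟩
    simp only [pow_zero, one_mul]
    exact hat_eq _ (hw x hx).1 (hw x hx).2
  | succ j ih =>
    obtain ⟨a', b', h', hv⟩ := ih
    refine ⟨_, _, h'.hat hp hq, fun x hx => ?_⟩
    rw [hat_eq, hv x hx, tri_two_tri, pow_succ']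
    · ring_nf
    · rw [hv x hx]; linarith [tri_nonneg (2 ^ j * (∑ i, w i * x i + t))]
    · rw [hv x hx]; linarith [tri_le (2 ^ j * (∑ i, w i * x i + t))]

lemma ReachAcc.sample {p0 : ℝ} {H : ℕ} {a b p q : (Fin d → ℝ) → ℝ} (h : ReachAcc p0 H a b p q)
    (hp : ∀ x, 0 ≤ p x) (hq : ∀ x, 0 ≤ q x) (ξ : Fin d → ℝ) (θ s c : ℝ) :
    ∃ a' b' p' q', ReachAcc p0 (H + (dbl ξ + 3)) a' b' p' q' ∧ (∀ x, 0 ≤ p' x) ∧ (∀ x, 0 ≤ q' x) ∧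
      ∀ x ∈ Set.Icc (0 : Fin d → ℝ) 1,
        p' x - q' x = p x - q x + c * max 0 (tri (∑ i, ξ i * x i + θ) - s) := by
  obtain ⟨n, hn⟩ := range_bound ξ θ
  set K := dbl ξ with hK
  have hK2 := two_pow_dbl ξ
  rw [← hK] at hK2
  have hpos : (0 : ℝ) < 2 ^ K := by positivity
  have key : ∀ x : Fin d → ℝ, ∑ i, (ξ i / 2 ^ K) * x i + (θ - n) / 2 ^ K =
      (∑ i, ξ i * x i + θ - n) / 2 ^ K := by
    intro x
    rw [add_sub_assoc, add_div, Finset.sum_div]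
    congr 1
    exact Finset.sum_congr rfl fun i _ => by ring
  obtain ⟨a', b', h', hv⟩ := h.hats hp hq (fun i => ξ i / 2 ^ K) ((θ - n) / 2 ^ K) (by
    intro x hx
    rw [key]
    obtain ⟨h1, h2⟩ := hn x hx
    exact ⟨by positivity, by rw [div_le_one hpos]; linarith⟩) K
  have h2 := (h'.emit hp hq s).flush (fun x => le_max_left _ _) hp hq c
  rw [show H + 1 + K + 1 + 1 = H + (K + 3) by omega] at h2
  refine ⟨_, _, _, _, h2, ?_, ?_, ?_⟩
  · intro x
    exact add_nonneg (hp x) (mul_nonneg (le_max_left _ _) (le_max_left _ _))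
  · intro x
    exact add_nonneg (hq x) (mul_nonneg (le_max_left _ _) (le_max_left _ _))
  · intro x hx
    have e := hv x hx
    rw [key, mul_div_cancel₀ _ hpos.ne', tri_sub_int] at e
    have e' : a' x - 2 * b' x = tri (∑ i, ξ i * x i + θ) := by linarith
    rw [e']
    have : max 0 c - max 0 (-c) = c := by
      rcases le_total 0 c with h | h
      · rw [max_eq_right h, max_eq_left (by linarith)]; ring
      · rw [max_eq_left h, max_eq_right (by linarith)]; ring
    linear_combination (max 0 (tri (∑ i, ξ i * x i + θ) - s)) * this

lemma net_list {ι : Type*} (ξ : ι → Fin d → ℝ) (θ s c : ι → ℝ) (p0 : ℝ) (hp0 : 0 ≤ p0)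
    (l : List ι) :
    ∃ a' b' p' q', ReachAcc p0 (l.map fun i => dbl (ξ i) + 3).sum a' b' p' q' ∧
      (∀ x, 0 ≤ p' x) ∧ (∀ x, 0 ≤ q' x) ∧
      ∀ x ∈ Set.Icc (0 : Fin d → ℝ) 1, p' x - q' x = p0 +
        (l.map fun k => c k * max 0 (tri (∑ i, ξ k i * x i + θ k) - s k)).sum := by
  induction l with
  | nil =>
    refine ⟨0, 0, fun _ => p0, 0, ⟨0, 0, fun x hx => ?_⟩, fun _ => hp0, fun _ => le_rfl, ?_⟩
    · simp [hiddenIter]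
    · intro x _; simp
  | cons k l ih =>
    obtain ⟨a, b, p, q, h, hp, hq, hv⟩ := ih
    obtain ⟨a', b', p', q', h', hp', hq', hv'⟩ := h.sample hp hq (ξ k) (θ k) (s k) (c k)
    refine ⟨a', b', p', q', ?_, hp', hq', fun x hx => ?_⟩
    · rw [List.map_cons, List.sum_cons, add_comm]; exact h'
    · rw [hv' x hx, hv x hx, List.map_cons, List.sum_cons]; ring

lemma net_exists {ι : Type*} (ξ : ι → Fin d → ℝ) (θ s c : ι → ℝ) (p0 : ℝ) (hp0 : 0 ≤ p0)
    (l : List ι) :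
    ∃ F, IsReLUNet d (d + 4) ((l.map fun i => dbl (ξ i) + 3).sum + 2) F ∧
      ∀ x ∈ Set.Icc (0 : Fin d → ℝ) 1, F x = p0 +
        (l.map fun k => c k * max 0 (tri (∑ i, ξ k i * x i + θ k) - s k)).sum := by
  obtain ⟨a, b, p, q, ⟨W, b', h⟩, -, -, hv⟩ := net_list ξ θ s c p0 hp0 l
  refine ⟨_, ⟨(Matrix.fromRows (1 : Matrix (Fin d) (Fin d) ℝ)
      (0 : Matrix (Fin 4) (Fin d) ℝ)).submatrix finSumFinEquiv.symm (Equiv.refl _),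
      stateOf 0 ![0, 0, p0, 0], W, b', stateOf 0 ![0, 0, 1, -1], fun x => rfl⟩, fun x hx => ?_⟩
  rw [init_state _ hp0 _ hx.1, Nat.add_sub_cancel, h x hx, ← hv x hx]
  rw [← finSumFinEquiv.sum_comp, Fintype.sum_sum_type]
  simp [stateOf, Fin.sum_univ_four]
  ring

end NetPart

section MaureyPart

lemma integrable_of_bdd {X : Type*} [MeasurableSpace X] (ρ : Measure X) [IsFiniteMeasure ρ]
    (f : X → ℝ) (hf : Measurable f) (C : ℝ) (hC : ∀ x, |f x| ≤ C) : Integrable f ρ :=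
  Integrable.of_bound hf.aestronglyMeasurable C (ae_of_all _ hC)

lemma maurey {α X : Type*} [MeasurableSpace α] [MeasurableSpace X] (ν : Measure α)
    [IsProbabilityMeasure ν] (ρ : Measure X) [IsFiniteMeasure ρ] (D : α → X → ℝ)
    (hD : Measurable (Function.uncurry D)) (M : ℝ) (hM : ∀ a x, |D a x| ≤ M)
    (h0 : ∀ x, ∫ a, D a x ∂ν = 0) (c : α → ℝ) (hc : Integrable c ν) (κ : ℝ) (hκ : 0 ≤ κ) (n : ℕ) :
    ∃ l : List α, l.length = n ∧ Measurable (fun x => (l.map fun a => D a x).sum) ∧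
      (∃ C, ∀ x, |(l.map fun a => D a x).sum| ≤ C) ∧
      κ * ∫ x, ((l.map fun a => D a x).sum) ^ 2 ∂ρ + (l.map c).sum ≤
        n * (κ * (M ^ 2 * ρ.real Set.univ) + ∫ a, c a ∂ν) := by
  induction n with
  | zero =>
    refine ⟨[], rfl, by simp, ⟨0, by simp⟩, by simp⟩
  | succ n ih =>
    obtain ⟨l, hl, hSm, ⟨C, hC⟩, hb⟩ := ih
    set S : X → ℝ := fun x => (l.map fun a => D a x).sum with hS
    have hDl : ∀ a, Measurable (D a) := fun a => hD.comp measurable_prodMk_left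
    have hDr : ∀ x, Measurable (fun a => D a x) := fun x => hD.comp measurable_prodMk_right
    have hM0 : ∀ a x, |D a x ^ 2| ≤ M ^ 2 := fun a x => by
      rw [abs_pow]; exact pow_le_pow_left₀ (abs_nonneg _) (hM a x) 2
    have hI : Integrable (Function.uncurry fun a x => (D a x + S x) ^ 2) (ν.prod ρ) := by
      refine integrable_of_bdd _ _ ?_ ((M + C) ^ 2) ?_
      · exact (hD.add (hSm.comp measurable_snd)).pow_const 2
      · rintro ⟨a, x⟩
        simp only [Function.uncurry]
        rw [abs_pow]
        exact pow_le_pow_left₀ (abs_nonneg _) ((abs_add_le _ _).trans (add_le_add (hM a x) (hC x))) 2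
    have hS2 : Integrable (fun x => S x ^ 2) ρ := by
      refine integrable_of_bdd _ _ (hSm.pow_const 2) (C ^ 2) fun x => ?_
      rw [abs_pow]
      exact pow_le_pow_left₀ (abs_nonneg _) (hC x) 2
    have hin : ∀ x, ∫ a, (D a x + S x) ^ 2 ∂ν ≤ M ^ 2 + S x ^ 2 := by
      intro x
      have i1 : Integrable (fun a => D a x) ν := integrable_of_bdd _ _ (hDr x) M (fun a => hM a x)
      have i2 : Integrable (fun a => D a x ^ 2) ν :=
        integrable_of_bdd _ _ ((hDr x).pow_const 2) _ (fun a => hM0 a x)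
      have e : ∫ a, (D a x + S x) ^ 2 ∂ν = ∫ a, D a x ^ 2 ∂ν + S x ^ 2 := by
        have : (fun a => (D a x + S x) ^ 2) = fun a => (D a x ^ 2 + 2 * S x * D a x) + S x ^ 2 := by
          ext a; ring
        have i3 : Integrable (fun a => D a x ^ 2 + 2 * S x * D a x) ν := i2.add (i1.const_mul _)
        rw [this, integral_add i3 (integrable_const _),
          integral_add i2 (i1.const_mul _), integral_const_mul, h0]
        simp
      rw [e]
      have : ∫ a, D a x ^ 2 ∂ν ≤ ∫ a, M ^ 2 ∂ν :=
        integral_mono i2 (integrable_const _) fun a => (le_abs_self _).trans (hM0 a x)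
      simp at this
      linarith
    have hΦ : Integrable (fun a => κ * ∫ x, (D a x + S x) ^ 2 ∂ρ + c a) ν :=
      (hI.integral_prod_left.const_mul κ).add hc
    have hJ : Integrable (fun a => ∫ x, (D a x + S x) ^ 2 ∂ρ) ν := hI.integral_prod_left
    obtain ⟨a, ha⟩ := exists_le_integral hΦ
    have hle : ∫ a, ∫ x, (D a x + S x) ^ 2 ∂ρ ∂ν ≤ M ^ 2 * ρ.real Set.univ + ∫ x, S x ^ 2 ∂ρ := by
      rw [integral_integral_swap hI]
      calc _ ≤ ∫ x, (M ^ 2 + S x ^ 2) ∂ρ :=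
            integral_mono hI.integral_prod_right ((integrable_const _).add hS2) hin
        _ = _ := by
            rw [integral_add (integrable_const _) hS2]; simp [mul_comm]
    rw [integral_add (hJ.const_mul κ) hc, integral_const_mul] at ha
    have hle' := mul_le_mul_of_nonneg_left hle hκ
    refine ⟨a :: l, by simp [hl], ?_, ⟨M + C, fun x => ?_⟩, ?_⟩
    · simp only [List.map_cons, List.sum_cons]
      exact (hDl a).add hSm
    · simp only [List.map_cons, List.sum_cons]
      exact (abs_add_le _ _).trans (add_le_add (hM a x) (hC x))
    · simp only [List.map_cons, List.sum_cons]
      push_cast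
      have ha' : κ * ∫ x, (D a x + S x) ^ 2 ∂ρ + c a ≤ _ := ha
      have hb' : κ * ∫ x, S x ^ 2 ∂ρ + (l.map c).sum ≤ _ := hb
      change κ * ∫ x, (D a x + S x) ^ 2 ∂ρ + (c a + (l.map c).sum) ≤ _
      linarith

lemma cos_rep (u : ℝ) (h0 : 0 ≤ u) (h1 : u ≤ 1 / 2) :
    ∫ s in Set.Ioc (0 : ℝ) 1, (1 - 2 * π ^ 2 * Real.cos (π * s) * max 0 (u - |s| / 2)) =
      Real.cos (2 * π * u) := by
  rw [← intervalIntegral.integral_of_le zero_le_one]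
  have hc : Continuous fun s : ℝ => 1 - 2 * π ^ 2 * Real.cos (π * s) * max 0 (u - |s| / 2) := by
    fun_prop
  rw [← intervalIntegral.integral_add_adjacent_intervals (b := 2 * u) (hc.intervalIntegrable _ _)
    (hc.intervalIntegrable _ _)]
  have e2 : ∫ s in (2 * u)..1, (1 - 2 * π ^ 2 * Real.cos (π * s) * max 0 (u - |s| / 2)) =
      ∫ s in (2 * u)..1, (1 : ℝ) := by
    refine intervalIntegral.integral_congr fun s hs => ?_
    rw [Set.uIcc_of_le (by linarith)] at hs
    rw [abs_of_nonneg (by linarith [hs.1]), max_eq_left (by linarith [hs.1])]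
    simp
  have e1 : ∫ s in (0 : ℝ)..(2 * u), (1 - 2 * π ^ 2 * Real.cos (π * s) * max 0 (u - |s| / 2)) =
      ∫ s in (0 : ℝ)..(2 * u), (1 - 2 * π ^ 2 * Real.cos (π * s) * (u - s / 2)) := by
    refine intervalIntegral.integral_congr fun s hs => ?_
    rw [Set.uIcc_of_le (by linarith)] at hs
    rw [abs_of_nonneg hs.1, max_eq_right (by linarith [hs.2])]
  have hd : ∀ s ∈ Set.uIcc 0 (2 * u), HasDerivAt
      (fun s => s - 2 * π * Real.sin (π * s) * (u - s / 2) + Real.cos (π * s))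
      (1 - 2 * π ^ 2 * Real.cos (π * s) * (u - s / 2)) s := by
    intro s _
    have a1 : HasDerivAt (fun s : ℝ => π * s) π s := by
      simpa using (hasDerivAt_id s).const_mul π
    have a2 : HasDerivAt (fun s : ℝ => u - s / 2) (-(1 / 2)) s := by
      simpa using ((hasDerivAt_id s).div_const 2).const_sub u
    have := ((hasDerivAt_id s).sub ((a1.sin.const_mul (2 * π)).mul a2)).add a1.cos
    refine HasDerivAt.congr_deriv (f := fun s => s - 2 * π * Real.sin (π * s) * (u - s / 2) +
      Real.cos (π * s)) this ?_
    ring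
  rw [e1, e2, intervalIntegral.integral_eq_sub_of_hasDerivAt hd
    (Continuous.intervalIntegrable (by fun_prop) _ _)]
  simp
  ring_nf

end MaureyPart

section MainPart

variable {d : ℕ}

/-- dictionary element -/
def feat (f : (Fin d → ℝ) → ℝ) (p : (Fin d → ℝ) × ℝ) (x : Fin d → ℝ) : ℝ :=
  1 - 2 * π ^ 2 * Real.cos (π * p.2) * max 0 (tri (∑ i, p.1 i * x i + phase f p.1) - |p.2| / 2)

lemma tri_measurable : Measurable tri :=
  measurable_fract.min (measurable_const.sub measurable_fract)

lemma feat_measurable (f : (Fin d → ℝ) → ℝ) (hf : Integrable f) :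
    Measurable (Function.uncurry (feat f)) := by
  have hph : Measurable (phase f) :=
    (Complex.measurable_arg.comp (fhat_continuous f hf).measurable).div_const _
  have h1 : Measurable fun q : ((Fin d → ℝ) × ℝ) × (Fin d → ℝ) =>
      tri (∑ i, q.1.1 i * q.2 i + phase f q.1.1) := by
    apply tri_measurable.comp
    apply Measurable.add
    · exact Continuous.measurable (by fun_prop)
    · exact hph.comp (measurable_fst.comp measurable_fst)
  unfold Function.uncurry feat
  have h2 : Measurable fun q : ((Fin d → ℝ) × ℝ) × (Fin d → ℝ) =>
      2 * π ^ 2 * Real.cos (π * q.1.2) := Continuous.measurable (by fun_prop)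
  have h3 : Measurable fun q : ((Fin d → ℝ) × ℝ) × (Fin d → ℝ) =>
      |q.1.2| / 2 := Continuous.measurable (by fun_prop)
  exact measurable_const.sub (h2.mul (measurable_const.max (h1.sub h3)))

lemma feat_measurable_left (f : (Fin d → ℝ) → ℝ) (hf : Integrable f) (x : Fin d → ℝ) :
    Measurable (fun p => feat f p x) :=
  Measurable.of_uncurry_right (feat_measurable f hf)

lemma feat_bound (f : (Fin d → ℝ) → ℝ) (p : (Fin d → ℝ) × ℝ) (x : Fin d → ℝ) :
    |feat f p x| ≤ 11 := by
  unfold feat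
  have hpi := Real.pi_lt_d2
  have hpi0 := Real.pi_pos
  have h1 : |2 * π ^ 2 * Real.cos (π * p.2) *
      max 0 (tri (∑ i, p.1 i * x i + phase f p.1) - |p.2| / 2)| ≤ 2 * π ^ 2 * 1 * (1 / 2) := by
    rw [abs_mul, abs_mul, abs_of_nonneg (show (0 : ℝ) ≤ 2 * π ^ 2 by positivity),
      abs_of_nonneg (le_max_left (0 : ℝ) _)]
    gcongr
    · exact Real.abs_cos_le_one _
    · apply max_le (by norm_num)
      linarith [tri_le (∑ i, p.1 i * x i + phase f p.1), abs_nonneg p.2]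
  have := abs_sub (1 : ℝ) (2 * π ^ 2 * Real.cos (π * p.2) *
      max 0 (tri (∑ i, p.1 i * x i + phase f p.1) - |p.2| / 2))
  rw [abs_one] at this
  nlinarith

/-- sampling measure on frequencies -/
def freqM (f : (Fin d → ℝ) → ℝ) : Measure (Fin d → ℝ) :=
  volume.withDensity fun ξ => ENNReal.ofReal (‖fhatR f ξ‖ / ∫ ξ, ‖fhatR f ξ‖)

lemma freqM_integral (f : (Fin d → ℝ) → ℝ) (hf : Integrable f) (g : (Fin d → ℝ) → ℝ) :
    ∫ ξ, g ξ ∂(freqM f) = (∫ ξ, ‖fhatR f ξ‖ * g ξ) / ∫ ξ, ‖fhatR f ξ‖ := by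
  unfold freqM
  have hA : 0 ≤ ∫ ξ, ‖fhatR f ξ‖ := integral_nonneg fun _ => norm_nonneg _
  have hm : Measurable fun ξ => ‖fhatR f ξ‖ / ∫ ξ, ‖fhatR f ξ‖ :=
    (fhat_continuous f hf).measurable.norm.div_const _
  rw [integral_withDensity_eq_integral_toReal_smul hm.ennreal_ofReal
    (ae_of_all _ fun _ => ENNReal.ofReal_lt_top), ← integral_div]
  refine integral_congr_ae (ae_of_all _ fun ξ => ?_)
  simp only [smul_eq_mul]
  rw [ENNReal.toReal_ofReal (by positivity)]
  ring

lemma freqM_prob (f : (Fin d → ℝ) → ℝ) (hf1 : Integrable (fhatR f))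
    (hA : 0 < ∫ ξ, ‖fhatR f ξ‖) : IsProbabilityMeasure (freqM f) := by
  constructor
  unfold freqM
  rw [withDensity_apply _ MeasurableSet.univ, Measure.restrict_univ,
    ← ofReal_integral_eq_lintegral_ofReal (hf1.norm.div_const _)
      (ae_of_all _ fun _ => by positivity), integral_div, div_self hA.ne', ENNReal.ofReal_one]

lemma freqM_integrable (f : (Fin d → ℝ) → ℝ) (hf : Integrable f) (g : (Fin d → ℝ) → ℝ)
    (hg : Integrable fun ξ => g ξ * ‖fhatR f ξ‖) : Integrable g (freqM f) := by
  unfold freqM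
  have hA : 0 ≤ ∫ ξ, ‖fhatR f ξ‖ := integral_nonneg fun _ => norm_nonneg _
  have hm : Measurable fun ξ => ‖fhatR f ξ‖ / ∫ ξ, ‖fhatR f ξ‖ :=
    (fhat_continuous f hf).measurable.norm.div_const _
  rw [integrable_withDensity_iff hm.ennreal_ofReal
    (ae_of_all _ fun _ => ENNReal.ofReal_lt_top)]
  refine (hg.div_const (∫ ξ, ‖fhatR f ξ‖)).congr (ae_of_all _ fun ξ => ?_)
  simp only
  rw [ENNReal.toReal_ofReal (by positivity)]
  ring

lemma cos_int_le (f : (Fin d → ℝ) → ℝ) (hf1 : Integrable (fhatR f)) (x : Fin d → ℝ) :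
    |∫ ξ, ‖fhatR f ξ‖ * Real.cos (2 * π * (∑ i, ξ i * x i + phase f ξ))| ≤
      ∫ ξ, ‖fhatR f ξ‖ := by
  rw [← Real.norm_eq_abs]
  refine norm_integral_le_of_norm_le hf1.norm (ae_of_all _ fun ξ => ?_)
  rw [norm_mul, norm_norm, Real.norm_eq_abs]
  exact mul_le_of_le_one_right (norm_nonneg _) (Real.abs_cos_le_one _)

lemma feat_mean (f : (Fin d → ℝ) → ℝ) (hf : Integrable f) (hf1 : Integrable (fhatR f))
    (hA : 0 < ∫ ξ, ‖fhatR f ξ‖) (x : Fin d → ℝ) :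
    ∫ p, feat f p x ∂((freqM f).prod (volume.restrict (Set.Ioc (0 : ℝ) 1))) =
      (∫ ξ, ‖fhatR f ξ‖ * Real.cos (2 * π * (∑ i, ξ i * x i + phase f ξ))) /
        ∫ ξ, ‖fhatR f ξ‖ := by
  have := freqM_prob f hf1 hA
  have hi : Integrable (fun p => feat f p x)
      ((freqM f).prod (volume.restrict (Set.Ioc (0 : ℝ) 1))) :=
    integrable_of_bdd _ _ (feat_measurable_left f hf x) 11 (fun p => feat_bound f p x)
  have h3 := freqM_integral f hf
    (fun ξ => Real.cos (2 * π * (∑ i, ξ i * x i + phase f ξ)))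
  rw [integral_prod _ hi, ← h3]
  refine integral_congr_ae (ae_of_all _ fun ξ => ?_)
  simp only [feat]
  rw [cos_rep _ (tri_nonneg _) (tri_le _), cos_tri]

lemma list_sum_identity {ι : Type*} (l : List ι) (A h : ℝ) (u v : ι → ℝ) (n : ℕ) (hn : 0 < n)
    (hl : l.length = n) :
    A * h - (A + (l.map fun k => -(u k * A / n) * v k).sum) =
      A / n * (l.map fun k => h - (1 - u k * v k)).sum := by
  have hn' : (n : ℝ) ≠ 0 := by positivity
  have : ∀ l : List ι, (l.length : ℝ) * (A * h - A) - n * (l.map fun k => -(u k * A / n) * v k).sum =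
      A * (l.map fun k => h - (1 - u k * v k)).sum := by
    intro l
    induction l with
    | nil => simp
    | cons k l ih =>
      simp only [List.length_cons, List.map_cons, List.sum_cons]
      push_cast
      have e : (n : ℝ) * (-(u k * A / n) * v k) = - (u k * A * v k) := by
        field_simp
      linear_combination ih - e
  have h2 := this l
  rw [hl] at h2
  rw [div_mul_eq_mul_div, ← h2]
  field_simp
  ring

lemma list_sum_le {ι : Type*} (l : List ι) (u : ι → ℕ) (v : ι → ℝ) (h : ∀ k, (u k : ℝ) ≤ v k) :
    (((l.map u).sum : ℕ) : ℝ) ≤ (l.map v).sum := by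
  induction l with
  | nil => simp
  | cons k l ih =>
    simp only [List.map_cons, List.sum_cons]
    rw [Nat.cast_add]
    exact add_le_add (h k) ih

lemma one_le_lam (ξ : Fin d → ℝ) : 1 ≤ Real.logb 2 (2 + l1 ξ) := by
  rw [Real.le_logb_iff_rpow_le (by norm_num) (by linarith [l1_nonneg ξ])]
  simp [l1_nonneg ξ]

lemma dbl_le (ξ : Fin d → ℝ) : ((dbl ξ + 3 : ℕ) : ℝ) ≤ 5 * Real.logb 2 (2 + l1 ξ) := by
  have h := one_le_lam ξ
  have := Nat.ceil_lt_add_one (show 0 ≤ Real.logb 2 (2 + l1 ξ) by linarith)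
  unfold dbl
  push_cast
  linarith

end MainPart

set_option maxHeartbeats 2000000 in
/-- If `f : ℝ^d → ℝ` has `f̂ ∈ L¹`, `‖f‖_{B^log} < ∞` and `‖f‖_{B⁰} > 0`,
then for every compact `Ω ⊆ [0,1]^d` and `m ≥ 1` there is a single ReLU network `F` of width
`d+4` and depth at most `6m ‖f‖_{B^log}/‖f‖_{B⁰}` with
`‖f - F‖_{L²(Ω)} ≤ (2π²/√m)|Ω|^{1/2}‖f‖_{B⁰}` (stated as the equivalent squared bound). -/
theorem L2_approx_unit_cube_deep (d : ℕ) (f : (Fin d → ℝ) → ℝ)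
    (hf1 : Integrable (fhatR f))
    (hflog : Integrable (fun ξ => Real.logb 2 (2 + l1 ξ) * ‖fhatR f ξ‖))
    (hB0 : 0 < B0 (fhatR f))
    (Ω : Set (Fin d → ℝ)) (hΩc : IsCompact Ω) (hΩ : Ω ⊆ Set.Icc 0 1)
    (m : ℕ) (hm : 0 < m) :
    ∃ (L : ℕ) (F : (Fin d → ℝ) → ℝ),
      IsReLUNet d (d + 4) L F ∧
      (L : ℝ) ≤ 6 * m * logBarron (fhatR f) / B0 (fhatR f) ∧
      (∫⁻ x in Ω, ENNReal.ofReal ((f x - F x) ^ 2)) ≤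
        ENNReal.ofReal ((2 * Real.pi ^ 2 / Real.sqrt m *
          Real.sqrt ((volume Ω).toReal) * B0 (fhatR f)) ^ 2) := by
  have hf : Integrable f := integrable_of_fhat f hB0
  set A := ∫ ξ, ‖fhatR f ξ‖ with hAdef
  set Λ := logBarron (fhatR f) with hΛdef
  have hB : B0 (fhatR f) = 2 * A := rfl
  have hA : 0 < A := by rw [hB] at hB0; linarith
  have hΛ : A ≤ Λ := by
    refine integral_mono hf1.norm hflog fun ξ => ?_
    exact le_mul_of_one_le_left (norm_nonneg _) (one_le_lam ξ)
  have hm' : (0 : ℝ) < m := by positivity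
  set V := (volume Ω).toReal with hV
  have hV0 : 0 ≤ V := ENNReal.toReal_nonneg
  have hVfin : volume Ω ≠ ⊤ := hΩc.measure_lt_top.ne
  have hΩm : MeasurableSet Ω := hΩc.measurableSet
  have hpi4 : (81 : ℝ) ≤ π ^ 4 := by
    calc (81 : ℝ) = 3 ^ 4 := by norm_num
      _ ≤ π ^ 4 := pow_le_pow_left₀ (by norm_num) Real.pi_gt_three.le 4
  have htarget : (2 * Real.pi ^ 2 / Real.sqrt m * Real.sqrt V * B0 (fhatR f)) ^ 2 =
      16 * π ^ 4 * V * A ^ 2 / m := by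
    rw [hB, mul_pow, mul_pow, div_pow, Real.sq_sqrt hV0, Real.sq_sqrt hm'.le]
    ring
  rw [htarget, hB]
  have hrep := fourier_repr f hf hf1
  set h0 : (Fin d → ℝ) → ℝ := fun x =>
    ∫ p, feat f p x ∂((freqM f).prod (volume.restrict (Set.Ioc (0 : ℝ) 1))) with hh0
  have hmean := feat_mean f hf hf1 hA
  have hh0A : ∀ x, |h0 x| ≤ 1 := by
    intro x
    simp only [hh0]
    rw [hmean, abs_div, abs_of_pos hA, div_le_one hA]
    exact cos_int_le f hf1 x
  have hfh0 : ∀ᵐ x, f x = A * h0 x := by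
    filter_upwards [hrep] with x hx
    simp only [hh0]
    rw [hmean, hx, mul_div_cancel₀ _ hA.ne']
  by_cases hcase : (m : ℝ) < 100 ∨ V = 0
  · refine ⟨2, fun _ => 0, ⟨0, 0, 0, 0, 0, fun x => by simp⟩, ?_, ?_⟩
    · have hm1 : (1 : ℝ) ≤ m := by exact_mod_cast hm
      rw [le_div_iff₀ (by positivity)]
      push_cast
      nlinarith
    · calc ∫⁻ x in Ω, ENNReal.ofReal ((f x - 0) ^ 2) ≤ ∫⁻ x in Ω, ENNReal.ofReal (A ^ 2) := by
            refine lintegral_mono_ae (ae_restrict_of_ae ?_)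
            filter_upwards [hfh0] with x hx
            apply ENNReal.ofReal_le_ofReal
            rw [sub_zero, hx, mul_pow]
            have := hh0A x
            have h2 : h0 x ^ 2 ≤ 1 := by rw [sq_le_one_iff_abs_le_one]; exact this
            nlinarith [sq_nonneg A]
        _ = ENNReal.ofReal (A ^ 2 * V) := by
            rw [setLIntegral_const, ENNReal.ofReal_mul (by positivity), hV, ENNReal.ofReal_toReal hVfin]
        _ ≤ _ := by
            apply ENNReal.ofReal_le_ofReal
            rw [le_div_iff₀ hm']
            rcases hcase with h | h
            · have : A ^ 2 * V * m ≤ A ^ 2 * V * (16 * π ^ 4) := by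
                gcongr
                linarith
              linarith
            · rw [h]; simp
  push Not at hcase
  obtain ⟨hm100, hVne⟩ := hcase
  have hVpos : 0 < V := lt_of_le_of_ne hV0 (Ne.symm hVne)
  set n := m / 4 with hn
  have hm100' : 100 ≤ m := by exact_mod_cast hm100
  have hn0 : 0 < n := by omega
  have hn1 : (n : ℝ) * 4 ≤ m := by exact_mod_cast (by omega : n * 4 ≤ m)
  have hn2 : (m : ℝ) ≤ n * 4 + 3 := by exact_mod_cast (by omega : m ≤ n * 4 + 3)
  have hn0' : (0 : ℝ) < n := by positivity
  set E := Λ / A with hE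
  have hE1 : 1 ≤ E := by rw [hE, le_div_iff₀ hA]; linarith
  have := freqM_prob f hf1 hA
  haveI : IsFiniteMeasure (volume.restrict Ω) := ⟨by simpa using hΩc.measure_lt_top⟩
  haveI : IsProbabilityMeasure (volume.restrict (Set.Ioc (0 : ℝ) 1)) := ⟨by simp⟩
  set ν := (freqM f).prod (volume.restrict (Set.Ioc (0 : ℝ) 1)) with hν
  have hfm := feat_measurable f hf
  have hh0m : Measurable h0 := (hfm.stronglyMeasurable.integral_prod_left').measurable
  have hfi : ∀ x, Integrable (fun p => feat f p x) ν := fun x =>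
    integrable_of_bdd _ _ (feat_measurable_left f hf x) 11 (fun p => feat_bound f p x)
  have hcint : Integrable (fun ξ => 5 * Real.logb 2 (2 + l1 ξ)) (freqM f) :=
    (freqM_integrable f hf _ hflog).const_mul 5
  have hc : Integrable (fun p : (Fin d → ℝ) × ℝ => 5 * Real.logb 2 (2 + l1 p.1)) ν :=
    hcint.comp_fst _
  have hcE : ∫ p, 5 * Real.logb 2 (2 + l1 p.1) ∂ν = 5 * E := by
    rw [hν, integral_fun_fst (fun ξ : Fin d → ℝ => 5 * Real.logb 2 (2 + l1 ξ))]
    simp only [probReal_univ, one_smul]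
    rw [integral_const_mul, freqM_integral f hf, hE, hΛdef, logBarron]
    simp only [mul_comm]
    rfl
  obtain ⟨l, hl, hSm, ⟨C, hC⟩, hbd⟩ := maurey ν (volume.restrict Ω)
    (fun p x => h0 x - feat f p x) ((hh0m.comp measurable_snd).sub hfm) 12
    (fun p x => (abs_sub _ _).trans (by linarith [hh0A x, feat_bound f p x]))
    (fun x => by
      rw [integral_sub (integrable_const _) (hfi x)]
      simp [hh0])
    (fun p => 5 * Real.logb 2 (2 + l1 p.1)) hc (E / (25 * V)) (by positivity) n
  rw [hcE] at hbd
  have hVr : (volume.restrict Ω).real Set.univ = V := by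
    simp [Measure.real, hV]
  rw [hVr] at hbd
  obtain ⟨F, hF, hFv⟩ := net_exists (d := d) (fun p : (Fin d → ℝ) × ℝ => p.1) (fun p => phase f p.1)
    (fun p => |p.2| / 2) (fun p => -(2 * π ^ 2 * Real.cos (π * p.2) * A / n)) A hA.le l
  set S : (Fin d → ℝ) → ℝ := fun x => (l.map fun p => h0 x - feat f p x).sum with hS
  have hbd2 : E / (25 * V) * (∫ x in Ω, S x ^ 2) +
      (l.map fun p : (Fin d → ℝ) × ℝ => 5 * Real.logb 2 (2 + l1 p.1)).sum ≤ n * (269 / 25 * E) := by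
    refine hbd.trans (le_of_eq ?_)
    field_simp
    ring
  have hS0 : 0 ≤ ∫ x in Ω, S x ^ 2 := integral_nonneg fun x => sq_nonneg _
  have hcost := list_sum_le l (fun p : (Fin d → ℝ) × ℝ => dbl p.1 + 3)
    (fun p => 5 * Real.logb 2 (2 + l1 p.1)) (fun p => dbl_le p.1)
  have hcost0 : 0 ≤ (l.map fun p : (Fin d → ℝ) × ℝ => 5 * Real.logb 2 (2 + l1 p.1)).sum :=
    (Nat.cast_nonneg _).trans hcost
  refine ⟨_, F, hF, ?_, ?_⟩
  · have e : 6 * (m : ℝ) * Λ / (2 * A) = 3 * m * E := by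
      rw [hE]; field_simp; ring
    rw [e]
    rw [Nat.cast_add, Nat.cast_ofNat]
    have : 0 ≤ E / (25 * V) * (∫ x in Ω, S x ^ 2) := by positivity
    have h5 : (n : ℝ) * E * 4 ≤ m * E := by nlinarith
    have h6 : 100 * 1 ≤ (m : ℝ) * E := by gcongr
    linarith
  · have hSsq : ∫ x in Ω, S x ^ 2 ≤ n * 269 * V := by
      have : E / (25 * V) * (∫ x in Ω, S x ^ 2) ≤ n * (269 / 25 * E) := by linarith
      rw [div_mul_eq_mul_div, div_le_iff₀ (by positivity)] at this
      have hEp : 0 < E := by linarith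
      refine le_of_mul_le_mul_left (this.trans (le_of_eq ?_)) hEp
      ring
    have hSi : Integrable (fun x => S x ^ 2) (volume.restrict Ω) := by
      refine integrable_of_bdd _ _ (hSm.pow_const 2) (C ^ 2) fun x => ?_
      rw [abs_pow]
      exact pow_le_pow_left₀ (abs_nonneg _) (hC x) 2
    calc ∫⁻ x in Ω, ENNReal.ofReal ((f x - F x) ^ 2)
        = ∫⁻ x in Ω, ENNReal.ofReal ((A / n) ^ 2 * S x ^ 2) := by
          refine setLIntegral_congr_fun_ae hΩm ?_
          filter_upwards [hfh0] with x hx hxΩ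
          rw [hFv x (hΩ hxΩ), hx, ← mul_pow,
            list_sum_identity l A (h0 x) (fun p => 2 * π ^ 2 * Real.cos (π * p.2)) _ n hn0 hl]
          rfl
      _ = ENNReal.ofReal ((A / n) ^ 2 * ∫ x in Ω, S x ^ 2) := by
          rw [← integral_const_mul, ofReal_integral_eq_lintegral_ofReal (hSi.const_mul _)
            (ae_of_all _ fun x => by positivity)]
      _ ≤ _ := by
          apply ENNReal.ofReal_le_ofReal
          calc (A / n) ^ 2 * ∫ x in Ω, S x ^ 2 ≤ (A / n) ^ 2 * (n * 269 * V) := by gcongr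
            _ = 269 * V * A ^ 2 / n := by field_simp
            _ ≤ 16 * π ^ 4 * V * A ^ 2 / m := by
              rw [div_le_div_iff₀ hn0' hm']
              have h1 : 269 * (m : ℝ) ≤ 16 * π ^ 4 * n := by nlinarith
              have h2 : 0 ≤ V * A ^ 2 := by positivity
              nlinarith

end
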